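/- Let (f_n) be a sequence of log-concave densities on ℝ^d, let C > 0 be such that f_n(x) ≤ C for all n and all x ∈ ℝ^d, and suppose there exist a compact set S ⊆ ℝ^d with positive Lebesgue measure and a constant c > 0 such that f_n(x) ≥ c for all n and all x ∈ S. Then there exist a₀ > 0 and b₀ ∈ ℝ such that f_n(x) ≤ exp(−a₀‖x‖ + b₀) for all n and all x ∈ ℝ^d; in particular, the sequence of probability measures with densities f_n is tight. -/

import Mathlib

open MeasureTheory

/-- A log-concave probability density on ℝ^d (with respect to Lebesgue measure). -/
def IsLogConcaveDensity {d : ℕ} (f : EuclideanSpace ℝ (Fin d) → ℝ) : Prop :=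
  Measurable f ∧ (∀ x, 0 ≤ f x) ∧ (∫ x, f x = 1) ∧
    ∀ x y : EuclideanSpace ℝ (Fin d), ∀ s t : ℝ, 0 ≤ s → 0 ≤ t → s + t = 1 →
      f x ^ s * f y ^ t ≤ f (s • x + t • y)

/-- A superlevel set of a function satisfying the log-concavity inequality is convex. -/
theorem IsLogConcaveDensity.convex_superlevel {d : ℕ} {f : EuclideanSpace ℝ (Fin d) → ℝ}
    (hf : IsLogConcaveDensity f) {c : ℝ} (hc : 0 < c) : Convex ℝ {x | c ≤ f x} := by
  intro x hx y hy s t hs ht hst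
  refine le_trans ?_ (hf.2.2.2 x y s t hs ht hst)
  calc c = c ^ s * c ^ t := by rw [← Real.rpow_add hc, hst, Real.rpow_one]
    _ ≤ f x ^ s * f y ^ t :=
      mul_le_mul (Real.rpow_le_rpow hc.le hx hs) (Real.rpow_le_rpow hc.le hy ht)
        (Real.rpow_nonneg hc.le _) (Real.rpow_nonneg (hf.2.1 x) _)

theorem IsLogConcaveDensity.integrable {d : ℕ} {f : EuclideanSpace ℝ (Fin d) → ℝ}
    (hf : IsLogConcaveDensity f) : Integrable f :=
  integrable_of_integral_eq_one hf.2.2.1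

/-- The convex hull of a set of positive measure has nonempty interior. -/
theorem exists_ball_subset_convexHull {E : Type*} [NormedAddCommGroup E] [NormedSpace ℝ E]
    [FiniteDimensional ℝ E] [MeasurableSpace E] [BorelSpace E] (μ : Measure E)
    [μ.IsAddHaarMeasure] {S : Set E} (hS : 0 < μ S) :
    ∃ x₀, ∃ r > 0, Metric.ball x₀ r ⊆ convexHull ℝ S := by
  obtain ⟨x₀, hx₀⟩ : (interior (convexHull ℝ S)).Nonempty := by
    rw [interior_convexHull_nonempty_iff_affineSpan_eq_top]
    by_contra h
    exact hS.ne' (measure_mono_null (subset_affineSpan ℝ S)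
      (Measure.addHaar_affineSubspace μ _ h))
  obtain ⟨r, hr, h⟩ := Metric.isOpen_iff.1 isOpen_interior x₀ hx₀
  exact ⟨x₀, r, hr, h.trans interior_subset⟩

/-- A convex set containing a ball and a point `x` contains the balls of half the radius centred
on the half of the segment towards `x`. -/
theorem Convex.ball_subset_of_ball_subset {E : Type*} [NormedAddCommGroup E] [NormedSpace ℝ E]
    {K : Set E} (hK : Convex ℝ K) {x₀ x : E} {r t : ℝ} (hball : Metric.ball x₀ r ⊆ K) (hx : x ∈ K)
    (ht₀ : 0 ≤ t) (ht : t ≤ 1 / 2) :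
    Metric.ball (x₀ + t • (x - x₀)) (r / 2) ⊆ K := by
  intro z hz
  have hpos : 0 < 1 - t := by linarith
  set v : E := (1 - t)⁻¹ • (z - (x₀ + t • (x - x₀))) with hv
  have hvr : x₀ + v ∈ Metric.ball x₀ r := by
    rw [mem_ball_iff_norm] at hz ⊢
    rw [add_sub_cancel_left, hv, norm_smul, Real.norm_of_nonneg (inv_nonneg.2 hpos.le),
      inv_mul_lt_iff₀ hpos]
    nlinarith [norm_nonneg (z - (x₀ + t • (x - x₀)))]
  have hz' : z = (1 - t) • (x₀ + v) + t • x := by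
    rw [smul_add, hv, smul_smul, mul_inv_cancel₀ hpos.ne']
    module
  rw [hz']
  exact hK (hball hvr) hx hpos.le ht₀ (by ring)

/-- A convex set containing a ball and a far away point has large measure. -/
theorem Convex.mul_measure_ball_le {E : Type*} [NormedAddCommGroup E] [NormedSpace ℝ E]
    [MeasurableSpace E] [BorelSpace E] (μ : Measure E) [μ.IsAddHaarMeasure]
    {K : Set E} (hK : Convex ℝ K) {x₀ x : E} {r : ℝ} (hr : 0 < r)
    (hball : Metric.ball x₀ r ⊆ K) (hx : x ∈ K) {N : ℕ} (hN : 2 * r * N ≤ ‖x - x₀‖) :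
    N * μ (Metric.ball 0 (r / 2)) ≤ μ K := by
  rcases Nat.eq_zero_or_pos N with rfl | hN₀
  · simp
  set ρ := ‖x - x₀‖ with hρ
  have hN₁ : (0 : ℝ) < N := by exact_mod_cast hN₀
  have hρ₀ : 0 < ρ := lt_of_lt_of_le (by positivity) hN
  let p : ℕ → E := fun k => x₀ + (k * r / ρ) • (x - x₀)
  have hsub : (⋃ k ∈ Finset.range N, Metric.ball (p k) (r / 2)) ⊆ K := by
    refine Set.iUnion₂_subset fun k hk => hK.ball_subset_of_ball_subset hball hx (by positivity) ?_
    have hk' : (k : ℝ) ≤ N := by exact_mod_cast (Finset.mem_range.1 hk).le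
    rw [div_le_iff₀ hρ₀]
    nlinarith
  have hdisj : (↑(Finset.range N) : Set ℕ).PairwiseDisjoint
      fun k => Metric.ball (p k) (r / 2) := by
    intro i _ j _ hij
    refine Metric.ball_disjoint_ball ?_
    have hd : dist (p i) (p j) = |(i : ℝ) - j| * r := by
      have : p i - p j = (((i : ℝ) - j) * r / ρ) • (x - x₀) := by
        simp only [p]
        module
      rw [dist_eq_norm, this, norm_smul, Real.norm_eq_abs, abs_div, abs_mul, abs_of_pos hr,
        abs_of_pos hρ₀, ← hρ, div_mul_cancel₀ _ hρ₀.ne']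
    have h1 : (1 : ℝ) ≤ |(i : ℝ) - j| := by
      have : (1 : ℤ) ≤ |(i : ℤ) - j| := Int.one_le_abs (sub_ne_zero.2 (by exact_mod_cast hij))
      exact_mod_cast this
    rw [hd]
    nlinarith
  calc N * μ (Metric.ball 0 (r / 2))
      = ∑ k ∈ Finset.range N, μ (Metric.ball (p k) (r / 2)) := by
        simp [Measure.addHaar_ball_center μ]
    _ = μ (⋃ k ∈ Finset.range N, Metric.ball (p k) (r / 2)) :=
        (measure_biUnion_finset hdisj fun _ _ => measurableSet_ball).symm
    _ ≤ μ K := measure_mono hsub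

/-- Log-concave densities that are bounded below by `c` on a fixed ball are uniformly smaller than
any given level `m ≤ c` far from the centre of the ball. -/
theorem exists_forall_logConcaveDensity_lt {d : ℕ} (x₀ : EuclideanSpace ℝ (Fin d)) {r c m : ℝ}
    (hr : 0 < r) (hm : 0 < m) (hmc : m ≤ c) :
    ∃ R > 0, ∀ f : EuclideanSpace ℝ (Fin d) → ℝ, IsLogConcaveDensity f →
      (∀ x ∈ Metric.ball x₀ r, c ≤ f x) → ∀ x, R ≤ ‖x - x₀‖ → f x < m := by
  set v := volume.real (Metric.ball (0 : EuclideanSpace ℝ (Fin d)) (r / 2)) with hv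
  have hv₀ : 0 < v := ENNReal.toReal_pos (Metric.measure_ball_pos _ _ (by positivity)).ne'
    measure_ball_lt_top.ne
  obtain ⟨N, hN⟩ := exists_nat_gt (1 / (m * v))
  have hN₀ : (0 : ℝ) < N := lt_of_le_of_lt (by positivity) hN
  refine ⟨2 * r * N, by positivity, fun f hf hball x hx => ?_⟩
  by_contra! hmx
  have hfin : volume {x | m ≤ f x} ≠ ⊤ := (hf.integrable.measure_ge_lt_top hm).ne
  have hvol := (hf.convex_superlevel hm).mul_measure_ball_le volume hr
    (fun y hy => hmc.trans (hball y hy)) hmx hx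
  have hvol' : N * v ≤ volume.real {x | m ≤ f x} := by
    simpa [hv, Measure.real] using ENNReal.toReal_mono hfin hvol
  have hmarkov := mul_meas_ge_le_integral_of_nonneg
    (Filter.Eventually.of_forall hf.2.1) hf.integrable m
  rw [hf.2.2.1] at hmarkov
  rw [div_lt_iff₀ (by positivity)] at hN
  nlinarith

/-- If a log-concave density is at least `c` at `x₀` and less than `c / e` at distance `R`
from `x₀`, then it decays exponentially outside the ball of radius `R`. -/
theorem IsLogConcaveDensity.le_mul_exp {d : ℕ} {f : EuclideanSpace ℝ (Fin d) → ℝ}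
    (hf : IsLogConcaveDensity f) {x₀ : EuclideanSpace ℝ (Fin d)} {c R : ℝ} (hc : 0 < c)
    (hR : 0 < R) (hx₀ : c ≤ f x₀) (hfar : ∀ x, R ≤ ‖x - x₀‖ → f x < c * Real.exp (-1))
    {x : EuclideanSpace ℝ (Fin d)} (hx : R ≤ ‖x - x₀‖) :
    f x ≤ c * Real.exp (-(‖x - x₀‖ / R)) := by
  set ρ := ‖x - x₀‖ with hρ
  have hρ₀ : 0 < ρ := hR.trans_le hx
  set s := R / ρ with hs
  have hs₀ : 0 < s := by positivity
  have hs₁ : s ≤ 1 := (div_le_one hρ₀).2 hx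
  have hy : R ≤ ‖((1 - s) • x₀ + s • x) - x₀‖ := by
    have : ((1 - s) • x₀ + s • x) - x₀ = s • (x - x₀) := by module
    rw [this, norm_smul, Real.norm_of_nonneg hs₀.le, ← hρ, hs, div_mul_cancel₀ _ hρ₀.ne']
  have hlt := (hf.2.2.2 x₀ x (1 - s) s (by linarith) hs₀.le (by ring)).trans_lt (hfar _ hy)
  by_contra! hcon
  refine hlt.not_ge ?_
  have hexp : (c * Real.exp (-(ρ / R))) ^ s = c ^ s * Real.exp (-1) := by
    rw [Real.mul_rpow hc.le (Real.exp_pos _).le, ← Real.exp_mul]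
    congr 2
    rw [hs]
    field_simp
  calc c * Real.exp (-1) = c ^ (1 - s) * (c * Real.exp (-(ρ / R))) ^ s := by
        rw [hexp, ← mul_assoc, ← Real.rpow_add hc, sub_add_cancel, Real.rpow_one]
    _ ≤ f x₀ ^ (1 - s) * f x ^ s :=
      mul_le_mul (Real.rpow_le_rpow hc.le hx₀ (by linarith))
        (Real.rpow_le_rpow (by positivity) hcon.le hs₀.le)
        (by positivity) (Real.rpow_nonneg (hf.2.1 _) _)

theorem integrable_exp_neg_mul_norm {E : Type*} [NormedAddCommGroup E] [NormedSpace ℝ E]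
    [FiniteDimensional ℝ E] [MeasurableSpace E] [BorelSpace E] (μ : Measure E)
    [μ.IsAddHaarMeasure] {a : ℝ} (ha : 0 < a) :
    Integrable (fun x : E => Real.exp (-a * ‖x‖)) μ := by
  set k := Module.finrank ℝ E + 1 with hk
  have hint : Integrable (fun x : E => (1 + ‖x‖) ^ (-(k : ℝ))) μ :=
    integrable_one_add_norm (by rw [hk]; push_cast; linarith)
  refine (hint.const_mul (Real.exp a * k.factorial / a ^ k)).mono'
    (by fun_prop) (Filter.Eventually.of_forall fun x => ?_)
  have hx := norm_nonneg x
  have h1 : 0 < 1 + ‖x‖ := by linarith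
  have h := Real.pow_div_factorial_le_exp (a * (1 + ‖x‖)) (by positivity) k
  have he : Real.exp (-a * ‖x‖) = Real.exp a / Real.exp (a * (1 + ‖x‖)) := by
    rw [← Real.exp_sub]
    ring_nf
  rw [Real.norm_of_nonneg (Real.exp_pos _).le, he, Real.rpow_neg h1.le, Real.rpow_natCast]
  calc Real.exp a / Real.exp (a * (1 + ‖x‖))
      ≤ Real.exp a / ((a * (1 + ‖x‖)) ^ k / k.factorial) := by gcongr
    _ = _ := by
      rw [mul_pow]
      field_simp

/-- Densities with a common integrable majorant have uniformly small tails. -/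
theorem exists_forall_setIntegral_ge_of_le_integrable {E : Type*} [NormedAddCommGroup E]
    [MeasurableSpace E] [BorelSpace E] {μ : Measure E} {g : E → ℝ} (hg : Integrable g μ) {ε : ℝ}
    (hε : 0 < ε) :
    ∃ R : ℝ, ∀ f : E → ℝ, Integrable f μ → (∀ x, f x ≤ g x) →
      ∫ x, f x ∂μ - ε ≤ ∫ x in {x : E | ‖x‖ ≤ R}, f x ∂μ := by
  have hmeas (R : ℝ) : MeasurableSet {x : E | ‖x‖ ≤ R} :=
    measurableSet_le measurable_norm measurable_const
  have hunion : ⋃ n : ℕ, {x : E | ‖x‖ ≤ n} = Set.univ :=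
    Set.eq_univ_of_forall fun x => Set.mem_iUnion.2 (exists_nat_ge ‖x‖)
  have hlim := tendsto_setIntegral_of_monotone (μ := μ) (f := g) (fun n : ℕ => hmeas n)
    (fun i j hij x (hx : ‖x‖ ≤ i) => hx.trans (by exact_mod_cast hij)) hg.integrableOn
  rw [hunion, setIntegral_univ] at hlim
  obtain ⟨n, hn⟩ := (hlim.eventually (lt_mem_nhds (sub_lt_self _ hε))).exists
  refine ⟨n, fun f hf hfg => ?_⟩
  have h1 := integral_add_compl (hmeas n) hf
  have h2 := integral_add_compl (hmeas n) hg
  have h3 : ∫ x in {x : E | ‖x‖ ≤ n}ᶜ, f x ∂μ ≤ ∫ x in {x : E | ‖x‖ ≤ n}ᶜ, g x ∂μ :=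
    setIntegral_mono hf.integrableOn hg.integrableOn hfg
  linarith

/-- A sequence of log-concave densities that is uniformly bounded above, and uniformly
bounded below on a compact set of positive Lebesgue measure, admits a common
exponential envelope `exp (−a₀‖x‖ + b₀)`; in particular the corresponding sequence of
probability measures is tight (tightness spelled out explicitly). -/
theorem logConcave_uniform_envelope_of_bounds {d : ℕ}
    (fs : ℕ → EuclideanSpace ℝ (Fin d) → ℝ) (hfs : ∀ n, IsLogConcaveDensity (fs n))
    (C : ℝ) (hC : 0 < C) (hupper : ∀ n x, fs n x ≤ C)
    (S : Set (EuclideanSpace ℝ (Fin d))) (hScompact : IsCompact S)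
    (hSpos : 0 < volume S)
    (c : ℝ) (hc : 0 < c) (hlower : ∀ n, ∀ x ∈ S, c ≤ fs n x) :
    (∃ a₀ > (0 : ℝ), ∃ b₀ : ℝ, ∀ n x, fs n x ≤ Real.exp (-a₀ * ‖x‖ + b₀)) ∧
      ∀ ε > (0 : ℝ), ∃ R : ℝ, ∀ n,
        1 - ε ≤ ∫ x in {x : EuclideanSpace ℝ (Fin d) | ‖x‖ ≤ R}, fs n x := by
  obtain ⟨x₀, r, hr, hball⟩ := exists_ball_subset_convexHull volume hSpos
  have hge (n : ℕ) : ∀ x ∈ Metric.ball x₀ r, c ≤ fs n x := fun x hx =>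
    convexHull_min (hlower n) ((hfs n).convex_superlevel hc) (hball hx)
  obtain ⟨R, hR, hfar⟩ := exists_forall_logConcaveDensity_lt x₀ hr
    (m := c * Real.exp (-1)) (c := c) (by positivity)
    (mul_le_of_le_one_right hc.le (Real.exp_le_one_iff.2 (by norm_num)))
  have hcC : c ≤ C := (hge 0 x₀ (Metric.mem_ball_self hr)).trans (hupper 0 x₀)
  have henv : ∃ a₀ > (0 : ℝ), ∃ b₀ : ℝ, ∀ n x, fs n x ≤ Real.exp (-a₀ * ‖x‖ + b₀) := by
    refine ⟨1 / R, by positivity, Real.log C + (1 + ‖x₀‖ / R), fun n x => ?_⟩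
    have hbound : fs n x ≤ C * Real.exp (1 - ‖x - x₀‖ / R) := by
      rcases le_total R ‖x - x₀‖ with hx | hx
      · refine ((hfs n).le_mul_exp hc hR (hge n x₀ (Metric.mem_ball_self hr))
          (hfar _ (hfs n) (hge n)) hx).trans ?_
        gcongr
        linarith
      · refine (hupper n x).trans (le_mul_of_one_le_right hC.le (Real.one_le_exp ?_))
        rw [sub_nonneg]
        exact (div_le_one hR).2 hx
    refine hbound.trans ?_
    have hsplit : -(1 / R) * ‖x‖ + (Real.log C + (1 + ‖x₀‖ / R)) =
        Real.log C + (1 - (‖x‖ - ‖x₀‖) / R) := by ring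
    rw [hsplit, Real.exp_add, Real.exp_log hC]
    gcongr
    exact norm_sub_norm_le x x₀
  refine ⟨henv, fun ε hε => ?_⟩
  obtain ⟨a₀, ha₀, b₀, hb⟩ := henv
  have hg : Integrable fun x : EuclideanSpace ℝ (Fin d) => Real.exp (-a₀ * ‖x‖ + b₀) := by
    simp_rw [Real.exp_add]
    exact (integrable_exp_neg_mul_norm volume ha₀).mul_const _
  obtain ⟨R', hR'⟩ := exists_forall_setIntegral_ge_of_le_integrable hg hε
  refine ⟨R', fun n => ?_⟩
  have h := hR' (fs n) (hfs n).integrable (hb n)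
  rwa [(hfs n).2.2.1] at h
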